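/- Let 𝒞 be a triangulated category with a proper class ξ of triangles and enough ξ-projectives. Given a ξ-exact sequence 0 → B → G₁ → G₀ → A → 0 with G₁, G₀ ∈ 𝒢𝒫(ξ), there exists a ξ-exact sequence 0 → B → G₁′ → Q → A → 0 with Q ξ-projective and G₁′ ∈ 𝒢𝒫(ξ). -/

import Mathlib

open CategoryTheory CategoryTheory.Limits CategoryTheory.Pretriangulated

namespace GorensteinTriangulated

variable {C : Type*} [Category C] [HasZeroObject C] [HasShift C ℤ] [Preadditive C]
  [∀ n : ℤ, (shiftFunctor C n).Additive] [Pretriangulated C]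

/-- A triangle `A ⟶ B ⟶ C ⟶ ΣA` is split if it is isomorphic to the triangle
`A ⟶ A ⊞ C ⟶ C ⟶ ΣA` with structure maps `(1 0)`, `(0 1)ᵀ` and `0`. -/
def IsSplitTriangle (T : Triangle C) : Prop :=
  Nonempty (T ≅ Triangle.mk (biprod.inl : T.obj₁ ⟶ T.obj₁ ⊞ T.obj₃) biprod.snd
    (0 : T.obj₃ ⟶ T.obj₁⟦(1 : ℤ)⟧))

/-- The triangle `T` becomes a short exact sequence after applying `Hom(Q, -)`. -/
def CoExact (T : Triangle C) (Q : C) : Prop :=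
  Function.Injective (fun φ : Q ⟶ T.obj₁ => φ ≫ T.mor₁) ∧
  (∀ φ : Q ⟶ T.obj₂, φ ≫ T.mor₂ = 0 → ∃ ψ : Q ⟶ T.obj₁, φ = ψ ≫ T.mor₁) ∧
  Function.Surjective (fun φ : Q ⟶ T.obj₂ => φ ≫ T.mor₂)

/-- The triangle `T` becomes a short exact sequence after applying `Hom(-, Q)`. -/
def ContraExact (T : Triangle C) (Q : C) : Prop :=
  Function.Injective (fun φ : T.obj₃ ⟶ Q => T.mor₂ ≫ φ) ∧
  (∀ φ : T.obj₂ ⟶ Q, T.mor₁ ≫ φ = 0 → ∃ ψ : T.obj₃ ⟶ Q, φ = T.mor₂ ≫ ψ) ∧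
  Function.Surjective (fun φ : T.obj₂ ⟶ Q => T.mor₁ ≫ φ)

/-- Saturation of a class of triangles with respect to base change: in a base change
diagram, if the third vertical triangle and the second horizontal triangle are in `S`,
then the original triangle is in `S`. -/
def SaturatedBase (S : Set (Triangle C)) : Prop :=
  ∀ T ∈ (distinguishedTriangles : Set (Triangle C)),
    ∀ (M G E : C) (α : M ⟶ G) (δ : M ⟶ E) (f' : T.obj₁ ⟶ G) (g' : G ⟶ E)
      (h' : E ⟶ T.obj₁⟦(1 : ℤ)⟧) (β : G ⟶ T.obj₂) (ε : E ⟶ T.obj₃)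
      (γ : T.obj₂ ⟶ M⟦(1 : ℤ)⟧) (ζ : T.obj₃ ⟶ M⟦(1 : ℤ)⟧),
      Triangle.mk α β γ ∈ (distinguishedTriangles : Set (Triangle C)) →
      Triangle.mk f' g' h' ∈ S → Triangle.mk δ ε ζ ∈ S →
      α ≫ g' = δ → f' ≫ β = T.mor₁ → g' ≫ ε = β ≫ T.mor₂ → h' = ε ≫ T.mor₃ →
      T.mor₂ ≫ ζ = γ → T ∈ S

/-- Saturation of a class of triangles with respect to cobase change: in a cobase change
diagram, if the second vertical triangle and the third horizontal triangle are in `S`,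
then the original triangle is in `S`. -/
def SaturatedCobase (S : Set (Triangle C)) : Prop :=
  ∀ T ∈ (distinguishedTriangles : Set (Triangle C)),
    ∀ (N D F : C) (ζ : N ⟶ T.obj₁) (δ : N ⟶ T.obj₂) (α : T.obj₁ ⟶ D) (β : T.obj₂ ⟶ F)
      (f' : D ⟶ F) (g' : F ⟶ T.obj₃) (h' : T.obj₃ ⟶ D⟦(1 : ℤ)⟧)
      (η : D ⟶ N⟦(1 : ℤ)⟧) (υ : F ⟶ N⟦(1 : ℤ)⟧),
      Triangle.mk ζ α η ∈ (distinguishedTriangles : Set (Triangle C)) →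
      Triangle.mk δ β υ ∈ S → Triangle.mk f' g' h' ∈ S →
      ζ ≫ T.mor₁ = δ → T.mor₁ ≫ β = α ≫ f' → T.mor₂ = β ≫ g' →
      T.mor₃ ≫ (shiftFunctor C (1 : ℤ)).map α = h' → f' ≫ υ = η → T ∈ S

/-- A proper class of triangles in the sense of Beligiannis. -/
structure IsProperClass (S : Set (Triangle C)) : Prop where
  subset_dist : S ⊆ (distinguishedTriangles : Set (Triangle C))
  split_mem : ∀ T : Triangle C, T ∈ (distinguishedTriangles : Set (Triangle C)) →
    IsSplitTriangle T → T ∈ S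
  iso_closed : ∀ T₁ T₂ : Triangle C, Nonempty (T₁ ≅ T₂) → T₁ ∈ S → T₂ ∈ S
  sum_closed : ∀ T₁ ∈ S, ∀ T₂ ∈ S, ∀ T ∈ (distinguishedTriangles : Set (Triangle C)),
    Nonempty (T.obj₁ ≅ T₁.obj₁ ⊞ T₂.obj₁) →
    (∀ e₁ : T.obj₁ ≅ T₁.obj₁ ⊞ T₂.obj₁, ∀ e₂ : T.obj₂ ≅ T₁.obj₂ ⊞ T₂.obj₂,
      ∀ e₃ : T.obj₃ ≅ T₁.obj₃ ⊞ T₂.obj₃,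
      T.mor₁ = e₁.hom ≫ biprod.map T₁.mor₁ T₂.mor₁ ≫ e₂.inv →
      T.mor₂ = e₂.hom ≫ biprod.map T₁.mor₂ T₂.mor₂ ≫ e₃.inv →
      T.mor₃ = e₃.hom ≫ biprod.desc
        (T₁.mor₃ ≫ (shiftFunctor C (1 : ℤ)).map (biprod.inl ≫ e₁.inv))
        (T₂.mor₃ ≫ (shiftFunctor C (1 : ℤ)).map (biprod.inr ≫ e₁.inv)) → T ∈ S)
  susp_closed : ∀ T ∈ S, ∀ i : ℤ, (Triangle.shiftFunctor C i).obj T ∈ S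
  saturated : SaturatedBase S
  base_change : ∀ T ∈ S, ∀ {E : C} (ε : E ⟶ T.obj₃),
    ∃ (G : C) (f' : T.obj₁ ⟶ G) (g' : G ⟶ E) (h' : E ⟶ T.obj₁⟦(1 : ℤ)⟧) (β : G ⟶ T.obj₂),
      Triangle.mk f' g' h' ∈ S ∧ f' ≫ β = T.mor₁ ∧ g' ≫ ε = β ≫ T.mor₂ ∧ h' = ε ≫ T.mor₃
  cobase_change : ∀ T ∈ S, ∀ {D : C} (α : T.obj₁ ⟶ D),
    ∃ (F : C) (f' : D ⟶ F) (g' : F ⟶ T.obj₃) (h' : T.obj₃ ⟶ D⟦(1 : ℤ)⟧) (β : T.obj₂ ⟶ F),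
      Triangle.mk f' g' h' ∈ S ∧ T.mor₁ ≫ β = α ≫ f' ∧ T.mor₂ = β ≫ g' ∧
      T.mor₃ ≫ (shiftFunctor C (1 : ℤ)).map α = h'

/-- `P` is a `ξ`-projective object. -/
def XiProjective (S : Set (Triangle C)) (P : C) : Prop :=
  ∀ T ∈ S, CoExact T P

/-- `𝒞` has enough `ξ`-projectives. -/
def HasEnoughXiProjectives (S : Set (Triangle C)) : Prop :=
  ∀ A : C, ∃ (K P : C) (f : K ⟶ P) (g : P ⟶ A) (h : A ⟶ K⟦(1 : ℤ)⟧),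
    XiProjective S P ∧ Triangle.mk f g h ∈ S

/-- The objects admitting a complete resolution by triangles in `S` with middle terms in
`X` which are `Hom(-, Y)`-exact; `GClass S X X` is the Gorenstein category `𝒢(X)` and
`GClass S (XiProjective S) (XiProjective S)` is the class of `ξ`-Gorenstein projectives. -/
def GClass (S : Set (Triangle C)) (X Y : C → Prop) (A : C) : Prop :=
  ∃ (K P : ℤ → C) (f : ∀ n : ℤ, K (n + 1) ⟶ P n) (g : ∀ n : ℤ, P n ⟶ K n)
    (h : ∀ n : ℤ, K n ⟶ (K (n + 1))⟦(1 : ℤ)⟧),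
    K 0 = A ∧ ∀ n : ℤ, X (P n) ∧ Triangle.mk (f n) (g n) (h n) ∈ S ∧
      ∀ Q : C, Y Q → ContraExact (Triangle.mk (f n) (g n) (h n)) Q

/-- `ξ`-Gorenstein projective objects. -/
def GProjective (S : Set (Triangle C)) (A : C) : Prop :=
  GClass S (XiProjective S) (XiProjective S) A

/-- A `ξ`-exact resolution `⋯ → X₁ → X₀ → A → 0` with terms satisfying `X`, which is
`Hom(-, Q)`-exact for every `Q` satisfying `Y`. -/
def HasResolution (S : Set (Triangle C)) (X Y : C → Prop) (A : C) : Prop :=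
  ∃ (K G : ℕ → C) (f : ∀ n : ℕ, K (n + 1) ⟶ G n) (g : ∀ n : ℕ, G n ⟶ K n)
    (h : ∀ n : ℕ, K n ⟶ (K (n + 1))⟦(1 : ℤ)⟧),
    K 0 = A ∧ ∀ n : ℕ, X (G n) ∧ Triangle.mk (f n) (g n) (h n) ∈ S ∧
      ∀ Q : C, Y Q → ContraExact (Triangle.mk (f n) (g n) (h n)) Q

/-- A `ξ`-exact coresolution `0 → A → X⁰ → X¹ → ⋯` with terms satisfying `X`, which is
`Hom(-, Q)`-exact for every `Q` satisfying `Y`. -/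
def HasCoresolution (S : Set (Triangle C)) (X Y : C → Prop) (A : C) : Prop :=
  ∃ (K G : ℕ → C) (f : ∀ n : ℕ, K n ⟶ G n) (g : ∀ n : ℕ, G n ⟶ K (n + 1))
    (h : ∀ n : ℕ, K (n + 1) ⟶ (K n)⟦(1 : ℤ)⟧),
    K 0 = A ∧ ∀ n : ℕ, X (G n) ∧ Triangle.mk (f n) (g n) (h n) ∈ S ∧
      ∀ Q : C, Y Q → ContraExact (Triangle.mk (f n) (g n) (h n)) Q

/-- A finite `ξ`-exact sequence `0 → Gₙ → ⋯ → G₀ → A → 0` where the `j`-th term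
satisfies the predicate `X j`. -/
def FiniteRes (S : Set (Triangle C)) (n : ℕ) (X : ℕ → C → Prop) (A : C) : Prop :=
  ∃ (K G : ℕ → C) (f : ∀ j : ℕ, K (j + 1) ⟶ G j) (g : ∀ j : ℕ, G j ⟶ K j)
    (h : ∀ j : ℕ, K j ⟶ (K (j + 1))⟦(1 : ℤ)⟧),
    K 0 = A ∧ IsZero (K (n + 1)) ∧
    ∀ j ≤ n, X j (G j) ∧ Triangle.mk (f j) (g j) (h j) ∈ S

/-- `ξ`-Gorenstein projective dimension of `A` is at most `n`. -/
def GpdLE (S : Set (Triangle C)) (A : C) (n : ℕ) : Prop :=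
  FiniteRes S n (fun _ => GProjective S) A

section Distinguished

variable {X Y Z : C}

lemma distinguished_neg₂₃ {f : X ⟶ Y} {g : Y ⟶ Z} {h : Z ⟶ X⟦(1 : ℤ)⟧}
    (hT : Triangle.mk f g h ∈ distTriang C) : Triangle.mk f (-g) (-h) ∈ distTriang C := by
  let e : Z ≅ Z := ⟨-𝟙 Z, -𝟙 Z, by simp, by simp⟩
  exact isomorphic_distinguished _ hT _
    (Triangle.isoMk _ _ (Iso.refl X) (Iso.refl Y) e
      (show f ≫ 𝟙 Y = 𝟙 X ≫ f by simp)
      (show (-g) ≫ (-𝟙 Z) = 𝟙 Y ≫ g by simp)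
      (show (-h) ≫ (𝟙 X)⟦(1 : ℤ)⟧' = (-𝟙 Z) ≫ h by simp))

lemma comp_mor₃_eq_zero {f : X ⟶ Y} {g : Y ⟶ Z} {h : Z ⟶ X⟦(1 : ℤ)⟧}
    (hT : Triangle.mk f g h ∈ distTriang C) : g ≫ h = 0 :=
  comp_distTriang_mor_zero₂₃ _ hT

lemma exists_lift_mor₂ {f : X ⟶ Y} {g : Y ⟶ Z} {h : Z ⟶ X⟦(1 : ℤ)⟧}
    (hT : Triangle.mk f g h ∈ distTriang C) {W : C} (φ : W ⟶ Z) (hφ : φ ≫ h = 0) :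
    ∃ ψ : W ⟶ Y, φ = ψ ≫ g :=
  Triangle.coyoneda_exact₃ _ hT φ hφ

lemma exists_lift_mor₃ {f : X ⟶ Y} {g : Y ⟶ Z} {h : Z ⟶ X⟦(1 : ℤ)⟧}
    (hT : Triangle.mk f g h ∈ distTriang C) {W : C} (φ : W ⟶ X⟦(1 : ℤ)⟧)
    (hφ : φ ≫ f⟦(1 : ℤ)⟧' = 0) : ∃ ψ : W ⟶ Z, φ = ψ ≫ h :=
  Triangle.coyoneda_exact₁ _ hT φ hφ

lemma exists_desc_mor₂ {f : X ⟶ Y} {g : Y ⟶ Z} {h : Z ⟶ X⟦(1 : ℤ)⟧}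
    (hT : Triangle.mk f g h ∈ distTriang C) {W : C} (φ : Y ⟶ W) (hφ : f ≫ φ = 0) :
    ∃ ψ : Z ⟶ W, φ = g ≫ ψ :=
  Triangle.yoneda_exact₂ _ hT φ hφ

lemma exists_desc_mor₃ {f : X ⟶ Y} {g : Y ⟶ Z} {h : Z ⟶ X⟦(1 : ℤ)⟧}
    (hT : Triangle.mk f g h ∈ distTriang C) {W : C} (φ : Z ⟶ W) (hφ : g ≫ φ = 0) :
    ∃ ψ : X⟦(1 : ℤ)⟧ ⟶ W, φ = h ≫ ψ :=
  Triangle.yoneda_exact₃ _ hT φ hφ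

/-- A distinguished triangle `X ⟶ Y ⟶ Z` with vanishing connecting morphism can be reversed
to a distinguished triangle `Z ⟶ Y ⟶ X` of a section and a retraction. -/
lemma exists_reversed_of_mor₃_eq_zero {f : X ⟶ Y} {g : Y ⟶ Z}
    (hT : Triangle.mk f g (0 : Z ⟶ X⟦(1 : ℤ)⟧) ∈ distTriang C) :
    ∃ (s : Z ⟶ Y) (r : Y ⟶ X), s ≫ g = 𝟙 Z ∧ f ≫ r = 𝟙 X ∧
      Triangle.mk s r (0 : X ⟶ Z⟦(1 : ℤ)⟧) ∈ distTriang C := by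
  obtain ⟨e, h₁, h₂⟩ : ∃ e : Y ≅ X ⊞ Z, f ≫ e.hom = biprod.inl ∧ g = e.hom ≫ biprod.snd :=
    exists_iso_binaryBiproduct_of_distTriang _ hT rfl
  refine ⟨biprod.inr ≫ e.inv, e.hom ≫ biprod.fst, by simp [h₂], by simp [reassoc_of% h₁],
    isomorphic_distinguished _ (binaryBiproductTriangle_distinguished Z X) _
      (Triangle.isoMk _ _ (Iso.refl Z) (e ≪≫ biprod.braiding X Z) (Iso.refl X)
        (show (biprod.inr ≫ e.inv) ≫ (e ≪≫ biprod.braiding X Z).hom = 𝟙 Z ≫ biprod.inl by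
          ext <;> simp)
        (show (e.hom ≫ biprod.fst) ≫ 𝟙 X = (e ≪≫ biprod.braiding X Z).hom ≫ biprod.snd by
          simp)
        (show (0 : X ⟶ Z⟦(1 : ℤ)⟧) ≫ (𝟙 Z)⟦(1 : ℤ)⟧' = 𝟙 X ≫ 0 by simp))⟩

end Distinguished

/-- A morphism annihilated by precomposition with morphisms from `ξ`-projective objects. -/
def IsPhantom (S : Set (Triangle C)) {U V : C} (h : U ⟶ V) : Prop :=
  ∀ P, XiProjective S P → ∀ φ : P ⟶ U, φ ≫ h = 0

/-- A morphism annihilated by postcomposition with morphisms to `ξ`-projective objects. -/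
def IsCophantom (S : Set (Triangle C)) {U V : C} (h : U ⟶ V) : Prop :=
  ∀ P, XiProjective S P → ∀ ψ : V ⟶ P, h ≫ ψ = 0

/-- A morphism which is both phantom and cophantom. -/
def IsBiphantom (S : Set (Triangle C)) {U V : C} (h : U ⟶ V) : Prop :=
  IsPhantom S h ∧ IsCophantom S h

section Phantom

variable {S : Set (Triangle C)} {U V W : C}

set_option linter.unusedSectionVars false

lemma IsPhantom.comp {h : U ⟶ V} (hh : IsPhantom S h) (k : V ⟶ W) : IsPhantom S (h ≫ k) :=
  fun P hP φ => by rw [← Category.assoc, hh P hP φ, zero_comp]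

lemma IsPhantom.precomp {k : V ⟶ W} (hk : IsPhantom S k) (h : U ⟶ V) : IsPhantom S (h ≫ k) :=
  fun P hP φ => by rw [← Category.assoc]; exact hk P hP _

lemma IsCophantom.comp {h : U ⟶ V} (hh : IsCophantom S h) (k : V ⟶ W) :
    IsCophantom S (h ≫ k) :=
  fun P hP ψ => by rw [Category.assoc]; exact hh P hP _

lemma IsCophantom.precomp {k : V ⟶ W} (hk : IsCophantom S k) (h : U ⟶ V) :
    IsCophantom S (h ≫ k) :=
  fun P hP ψ => by rw [Category.assoc, hk P hP ψ, comp_zero]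

lemma IsBiphantom.comp {h : U ⟶ V} (hh : IsBiphantom S h) (k : V ⟶ W) :
    IsBiphantom S (h ≫ k) :=
  ⟨hh.1.comp k, hh.2.comp k⟩

lemma IsBiphantom.precomp {k : V ⟶ W} (hk : IsBiphantom S k) (h : U ⟶ V) :
    IsBiphantom S (h ≫ k) :=
  ⟨hk.1.precomp h, hk.2.precomp h⟩

end Phantom

section ProperClass

variable {S : Set (Triangle C)}

lemma isPhantom_mor₃ (hS : IsProperClass S) {T : Triangle C} (hT : T ∈ S) :
    IsPhantom S T.mor₃ := by
  intro P hP φ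
  obtain ⟨ψ, rfl⟩ := (hP T hT).2.2 φ
  dsimp
  rw [Category.assoc, comp_distTriang_mor_zero₂₃ _ (hS.subset_dist hT), comp_zero]

lemma comp_mor₃_eq_zero_of_shift (hS : IsProperClass S) {P : C}
    (hP : ∀ T ∈ S, ∀ φ : P ⟶ T.obj₃, φ ≫ T.mor₃ = 0)
    {T : Triangle C} (hT : T ∈ S) (φ : P⟦(1 : ℤ)⟧ ⟶ T.obj₃) : φ ≫ T.mor₃ = 0 := by
  have h : ((shiftShiftNeg P (1 : ℤ)).inv ≫ φ⟦(-1 : ℤ)⟧') ≫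
      ((-1 : ℤ).negOnePow • T.mor₃⟦(-1 : ℤ)⟧' ≫ (shiftFunctorComm C 1 (-1)).hom.app T.obj₁) = 0 :=
    hP _ (hS.susp_closed T hT (-1)) _
  apply (shiftFunctor C (-1 : ℤ)).map_injective
  rw [Functor.map_zero, ← Preadditive.IsIso.comp_left_eq_zero (shiftShiftNeg P (1 : ℤ)).inv,
    Functor.map_comp]
  simpa only [Int.negOnePow_neg, Int.negOnePow_one, Units.neg_smul, one_smul,
    Preadditive.comp_neg, neg_eq_zero, ← Category.assoc,
    Preadditive.IsIso.comp_right_eq_zero] using h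

lemma xiProjective_iff (hS : IsProperClass S) {P : C} :
    XiProjective S P ↔ ∀ T ∈ S, ∀ φ : P ⟶ T.obj₃, φ ≫ T.mor₃ = 0 := by
  refine ⟨fun hP T hT => isPhantom_mor₃ hS hT P hP, fun h T hT => ?_⟩
  have hd := hS.subset_dist hT
  refine ⟨fun φ φ' e => ?_, fun φ hφ => Triangle.coyoneda_exact₂ _ hd φ hφ, fun φ => ?_⟩
  · dsimp at e
    rw [← sub_eq_zero, ← Preadditive.sub_comp] at e
    obtain ⟨ψ, hψ⟩ := Triangle.coyoneda_exact₁ _ hd ((φ - φ')⟦(1 : ℤ)⟧')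
      (by rw [← Functor.map_comp, e, Functor.map_zero])
    rw [comp_mor₃_eq_zero_of_shift hS h hT] at hψ
    exact sub_eq_zero.1 ((shiftFunctor C (1 : ℤ)).map_injective (by rw [hψ, Functor.map_zero]))
  · obtain ⟨ψ, hψ⟩ := Triangle.coyoneda_exact₃ _ hd φ (h T hT φ)
    exact ⟨ψ, hψ.symm⟩

lemma XiProjective.shift (hS : IsProperClass S) {P : C} (hP : XiProjective S P) :
    XiProjective S (P⟦(1 : ℤ)⟧) :=
  (xiProjective_iff hS).2 fun _ hT =>
    comp_mor₃_eq_zero_of_shift hS ((xiProjective_iff hS).1 hP) hT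

lemma XiProjective.of_extension (hS : IsProperClass S) {X Y Z : C} {f : X ⟶ Y} {g : Y ⟶ Z}
    (hT : Triangle.mk f g (0 : Z ⟶ X⟦(1 : ℤ)⟧) ∈ distTriang C)
    (hX : XiProjective S X) (hZ : XiProjective S Z) : XiProjective S Y := by
  refine (xiProjective_iff hS).2 fun T hTS φ => ?_
  have hw := isPhantom_mor₃ hS hTS
  obtain ⟨k, hk⟩ := exists_desc_mor₂ hT (φ ≫ T.mor₃)
    (by rw [← Category.assoc]; exact hw X hX _)
  obtain ⟨s, -, hs, -, -⟩ := exists_reversed_of_mor₃_eq_zero hT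
  have hk0 : k = 0 := by
    rw [← Category.id_comp k, ← hs, Category.assoc, ← hk, ← Category.assoc]
    exact hw Z hZ _
  rw [hk, hk0, comp_zero]

lemma isCophantom_of_contraExact {X Y Z : C} {f : X ⟶ Y} {g : Y ⟶ Z} {h : Z ⟶ X⟦(1 : ℤ)⟧}
    (hT : Triangle.mk f g h ∈ distTriang C)
    (hc : ∀ Q, XiProjective S Q → ContraExact (Triangle.mk f g h) Q) : IsCophantom S h := by
  intro Q hQ ψ
  apply (hc Q hQ).1
  change g ≫ h ≫ ψ = g ≫ 0
  rw [← Category.assoc, comp_mor₃_eq_zero hT, zero_comp, comp_zero]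

lemma contraExact_of_isCophantom (hS : IsProperClass S) {X Y Z : C} {f : X ⟶ Y} {g : Y ⟶ Z}
    {h : Z ⟶ X⟦(1 : ℤ)⟧} (hT : Triangle.mk f g h ∈ distTriang C) (hh : IsCophantom S h)
    {Q : C} (hQ : XiProjective S Q) : ContraExact (Triangle.mk f g h) Q := by
  refine ⟨fun (φ : Z ⟶ Q) (φ' : Z ⟶ Q) (e : g ≫ φ = g ≫ φ') => ?_,
    fun φ hφ => exists_desc_mor₂ hT φ hφ, fun (φ : X ⟶ Q) => ?_⟩
  · obtain ⟨ψ, hψ⟩ := exists_desc_mor₃ hT (φ - φ')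
      (by rw [Preadditive.comp_sub, e, sub_self])
    rw [hh Q hQ] at hψ
    exact sub_eq_zero.1 hψ
  · obtain ⟨ψ, hψ⟩ : ∃ ψ : Y⟦(1 : ℤ)⟧ ⟶ Q⟦(1 : ℤ)⟧, φ⟦(1 : ℤ)⟧' = (-f⟦(1 : ℤ)⟧') ≫ ψ :=
      exists_desc_mor₃ (rot_of_distTriang _ hT) _ (hh _ (hQ.shift hS) _)
    obtain ⟨ψ, rfl⟩ := (shiftFunctor C (1 : ℤ)).map_surjective ψ
    have e : (f ≫ (-ψ))⟦(1 : ℤ)⟧' = φ⟦(1 : ℤ)⟧' := by rw [hψ]; simp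
    exact ⟨-ψ, (shiftFunctor C (1 : ℤ)).map_injective e⟩

lemma mem_of_mor₃_eq_zero (hS : IsProperClass S) {X Y Z : C} {f : X ⟶ Y} {g : Y ⟶ Z}
    (hT : Triangle.mk f g (0 : Z ⟶ X⟦(1 : ℤ)⟧) ∈ distTriang C) :
    Triangle.mk f g (0 : Z ⟶ X⟦(1 : ℤ)⟧) ∈ S := by
  obtain ⟨e, h₁, h₂⟩ : ∃ e : Y ≅ X ⊞ Z, f ≫ e.hom = biprod.inl ∧ g = e.hom ≫ biprod.snd :=
    exists_iso_binaryBiproduct_of_distTriang _ hT rfl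
  exact hS.split_mem _ hT ⟨Triangle.isoMk _ _ (Iso.refl X) e (Iso.refl Z)
    (show f ≫ e.hom = 𝟙 X ≫ biprod.inl by rw [h₁, Category.id_comp])
    (show g ≫ 𝟙 Z = e.hom ≫ biprod.snd by rw [h₂, Category.comp_id])
    (show (0 : Z ⟶ X⟦(1 : ℤ)⟧) ≫ (𝟙 X)⟦(1 : ℤ)⟧' = 𝟙 Z ≫ 0 by simp)⟩

end ProperClass

variable [IsTriangulated C]

section Triangulated

variable {X Y Z : C}

/-- Base change of a distinguished triangle along the second morphism of another one. -/
lemma exists_base_change {f : X ⟶ Y} {g : Y ⟶ Z} {h : Z ⟶ X⟦(1 : ℤ)⟧}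
    (hT : Triangle.mk f g h ∈ distTriang C) {M E : C} {δ : M ⟶ E} {ε : E ⟶ Z}
    {ζ : Z ⟶ M⟦(1 : ℤ)⟧} (hT' : Triangle.mk δ ε ζ ∈ distTriang C) :
    ∃ (G : C) (α : M ⟶ G) (β : G ⟶ Y) (f' : X ⟶ G) (g' : G ⟶ E),
      Triangle.mk α β (g ≫ ζ) ∈ distTriang C ∧ Triangle.mk f' g' (ε ≫ h) ∈ distTriang C ∧
      α ≫ g' = δ ∧ f' ≫ β = f ∧ g' ≫ ε = β ≫ g := by
  obtain ⟨G, α, β, hG⟩ := distinguished_cocone_triangle₂ (g ≫ ζ)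
  have hT'' : Triangle.mk ε ζ (-δ⟦(1 : ℤ)⟧') ∈ distTriang C := rot_of_distTriang _ hT'
  have hG' : Triangle.mk β (g ≫ ζ) (-α⟦(1 : ℤ)⟧') ∈ distTriang C := rot_of_distTriang _ hG
  have o := Triangulated.someOctahedron' rfl hT hT'' hG'
  refine ⟨G, α, β, o.m₁, o.m₃, hG, o.mem, ?_, o.comm₁, o.comm₄⟩
  have : (-α⟦(1 : ℤ)⟧') ≫ o.m₃⟦(1 : ℤ)⟧' = -δ⟦(1 : ℤ)⟧' := o.comm₃
  rw [Preadditive.neg_comp, neg_inj, ← Functor.map_comp] at this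
  exact (shiftFunctor C (1 : ℤ)).map_injective this

/-- Cobase change of a distinguished triangle along the first morphism of another one. -/
lemma exists_cobase_change {f : X ⟶ Y} {g : Y ⟶ Z} {h : Z ⟶ X⟦(1 : ℤ)⟧}
    (hT : Triangle.mk f g h ∈ distTriang C) {E M : C} {δ : X ⟶ E} {ε : E ⟶ M}
    {ζ : M ⟶ X⟦(1 : ℤ)⟧} (hT' : Triangle.mk δ ε ζ ∈ distTriang C) :
    ∃ (G : C) (a : Y ⟶ G) (b : G ⟶ M) (c : E ⟶ G) (d : G ⟶ Z),
      Triangle.mk a b (ζ ≫ f⟦(1 : ℤ)⟧') ∈ distTriang C ∧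
      Triangle.mk c d (h ≫ δ⟦(1 : ℤ)⟧') ∈ distTriang C := by
  obtain ⟨G, a, b, hG⟩ := distinguished_cocone_triangle₂ (ζ ≫ f⟦(1 : ℤ)⟧')
  have hf := distinguished_neg₂₃ (rot_of_distTriang _ (rot_of_distTriang _ hT))
  have hf' : Triangle.mk h (f⟦(1 : ℤ)⟧') (g⟦(1 : ℤ)⟧') ∈ distTriang C := by
    have : Triangle.mk h (- -f⟦(1 : ℤ)⟧') (- -g⟦(1 : ℤ)⟧') ∈ distTriang C := hf
    rwa [neg_neg, neg_neg] at this
  have o := Triangulated.someOctahedron' (u₁₃ := ζ ≫ f⟦(1 : ℤ)⟧') rfl (rot_of_distTriang _ hT')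
    hf' (rot_of_distTriang _ hG)
  refine ⟨G, a, b, o.m₁, -o.m₃, hG, ?_⟩
  have : Triangle.mk o.m₁ (-o.m₃) (-(h ≫ (-δ⟦(1 : ℤ)⟧'))) ∈ distTriang C :=
    distinguished_neg₂₃ o.mem
  rwa [Preadditive.comp_neg, neg_neg] at this

/-- Composition of the second morphisms of two distinguished triangles. -/
lemma exists_fiber_comp {F₁ F₂ : C} {a₁ : F₁ ⟶ X} {g₁ : X ⟶ Y} {h₁ : Y ⟶ F₁⟦(1 : ℤ)⟧}
    (hT₁ : Triangle.mk a₁ g₁ h₁ ∈ distTriang C) {a₂ : F₂ ⟶ Y} {g₂ : Y ⟶ Z}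
    {h₂ : Z ⟶ F₂⟦(1 : ℤ)⟧} (hT₂ : Triangle.mk a₂ g₂ h₂ ∈ distTriang C) (S : Set (Triangle C)) :
    ∃ (F : C) (a : F ⟶ X) (h : Z ⟶ F⟦(1 : ℤ)⟧) (m : F₁ ⟶ F) (n : F ⟶ F₂),
      Triangle.mk a (g₁ ≫ g₂) h ∈ distTriang C ∧ Triangle.mk m n (a₂ ≫ h₁) ∈ distTriang C ∧
      (IsPhantom S h₁ → IsPhantom S h₂ → IsPhantom S h) ∧
      (IsCophantom S h₁ → IsCophantom S h₂ → IsCophantom S h) := by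
  obtain ⟨F, a, h, hT⟩ := distinguished_cocone_triangle₁ (g₁ ≫ g₂)
  have o := Triangulated.someOctahedron' rfl hT₁ hT₂ hT
  refine ⟨F, a, h, o.m₁, o.m₃, hT, o.mem, fun H₁ H₂ P hP φ => ?_, fun H₁ H₂ P hP ψ => ?_⟩
  · obtain ⟨φ', rfl⟩ := exists_lift_mor₂ hT₂ φ (H₂ P hP φ)
    rw [Category.assoc, ← o.comm₂, ← Category.assoc, H₁ P hP, zero_comp]
  · obtain ⟨t, ht⟩ := exists_desc_mor₃ hT₂ (h ≫ ψ)
      (by rw [← Category.assoc, ← o.comm₂, Category.assoc, H₁ P hP])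
    rw [ht, H₂ P hP]

/-- Composition of the first morphisms of two distinguished triangles. -/
lemma exists_cofiber_comp {Z₁ Z₂ : C} {u₁ : X ⟶ Y} {v₁ : Y ⟶ Z₁} {w₁ : Z₁ ⟶ X⟦(1 : ℤ)⟧}
    (hT₁ : Triangle.mk u₁ v₁ w₁ ∈ distTriang C) {u₂ : Y ⟶ Z} {v₂ : Z ⟶ Z₂}
    {w₂ : Z₂ ⟶ Y⟦(1 : ℤ)⟧} (hT₂ : Triangle.mk u₂ v₂ w₂ ∈ distTriang C) (S : Set (Triangle C)) :
    ∃ (W : C) (v : Z ⟶ W) (w : W ⟶ X⟦(1 : ℤ)⟧) (m : Z₁ ⟶ W) (n : W ⟶ Z₂),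
      Triangle.mk (u₁ ≫ u₂) v w ∈ distTriang C ∧
      Triangle.mk m n (w₂ ≫ v₁⟦(1 : ℤ)⟧') ∈ distTriang C ∧
      (IsPhantom S w₁ → IsPhantom S w₂ → IsPhantom S w) ∧
      (IsCophantom S w₁ → IsCophantom S w₂ → IsCophantom S w) := by
  obtain ⟨W, v, w, hT⟩ := distinguished_cocone_triangle (u₁ ≫ u₂)
  have o := Triangulated.someOctahedron rfl hT₁ hT₂ hT
  refine ⟨W, v, w, o.m₁, o.m₃, hT, o.mem, fun H₁ H₂ P hP φ => ?_, fun H₁ H₂ P hP ψ => ?_⟩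
  · obtain ⟨t, ht⟩ := exists_lift_mor₃ hT₁ (φ ≫ w)
      (by rw [Category.assoc, o.comm₄, ← Category.assoc, H₂ P hP])
    rw [ht, H₁ P hP]
  · obtain ⟨t, rfl⟩ : ∃ t : Y⟦(1 : ℤ)⟧ ⟶ P, ψ = (-u₁⟦(1 : ℤ)⟧') ≫ t :=
      exists_desc_mor₃ (rot_of_distTriang _ hT₁) ψ (H₁ P hP ψ)
    rw [Preadditive.neg_comp, Preadditive.comp_neg, ← Category.assoc, o.comm₄, Category.assoc,
      H₂ P hP, comp_zero, neg_zero]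

end Triangulated

section EnoughProjectives

variable {S : Set (Triangle C)}

/-- With enough `ξ`-projectives, a distinguished triangle with phantom connecting morphism
belongs to the proper class. -/
lemma mem_of_isPhantom (hS : IsProperClass S) (hE : HasEnoughXiProjectives S) {X Y Z : C}
    {f : X ⟶ Y} {g : Y ⟶ Z} {h : Z ⟶ X⟦(1 : ℤ)⟧} (hT : Triangle.mk f g h ∈ distTriang C)
    (hh : IsPhantom S h) : Triangle.mk f g h ∈ S := by
  obtain ⟨M, P, δ, ε, ζ, hP, hM⟩ := hE Z
  obtain ⟨G, α, β, f', g', hα, hf', h₁, h₂, h₃⟩ := exists_base_change hT (hS.subset_dist hM)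
  have hmem : Triangle.mk f' g' (ε ≫ h) ∈ S := by
    rw [hh P hP ε] at hf' ⊢
    exact mem_of_mor₃_eq_zero hS hf'
  exact hS.saturated _ hT M G P α δ f' g' (ε ≫ h) β ε (g ≫ ζ) ζ hα hmem hM h₁ h₂ h₃ rfl rfl

/-- `A'` is a syzygy of `A`: there is a distinguished triangle `A' ⟶ P ⟶ A` with `P`
`ξ`-projective and biphantom connecting morphism. -/
def IsSyzygy (S : Set (Triangle C)) (A' A : C) : Prop :=
  ∃ (P : C) (f : A' ⟶ P) (g : P ⟶ A) (h : A ⟶ A'⟦(1 : ℤ)⟧),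
    XiProjective S P ∧ Triangle.mk f g h ∈ distTriang C ∧ IsBiphantom S h

lemma gProjective_iff (hS : IsProperClass S) (hE : HasEnoughXiProjectives S) {A : C} :
    GProjective S A ↔ ∃ K : ℤ → C, K 0 = A ∧ ∀ n, IsSyzygy S (K (n + 1)) (K n) := by
  constructor
  · rintro ⟨K, P, f, g, h, h0, H⟩
    refine ⟨K, h0, fun n => ?_⟩
    obtain ⟨hP, hT, hc⟩ := H n
    exact ⟨P n, f n, g n, h n, hP, hS.subset_dist hT, isPhantom_mor₃ hS hT,
      isCophantom_of_contraExact (hS.subset_dist hT) hc⟩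
  · rintro ⟨K, h0, H⟩
    choose P f g h hP hT hh using H
    exact ⟨K, P, f, g, h, h0, fun n => ⟨hP n, mem_of_isPhantom hS hE (hT n) (hh n).1,
      fun Q hQ => contraExact_of_isCophantom hS (hT n) (hh n).2 hQ⟩⟩

lemma GProjective.exists_syzygy (hS : IsProperClass S) (hE : HasEnoughXiProjectives S) {A : C}
    (hA : GProjective S A) : ∃ A', IsSyzygy S A' A ∧ GProjective S A' := by
  obtain ⟨K, rfl, H⟩ := (gProjective_iff hS hE).1 hA
  exact ⟨K (0 + 1), H 0, (gProjective_iff hS hE).2 ⟨fun n => K (n + 1), rfl, fun n => H (n + 1)⟩⟩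

lemma GProjective.exists_cosyzygy (hS : IsProperClass S) (hE : HasEnoughXiProjectives S) {A : C}
    (hA : GProjective S A) : ∃ A', IsSyzygy S A A' ∧ GProjective S A' := by
  obtain ⟨K, rfl, H⟩ := (gProjective_iff hS hE).1 hA
  have hK : ∀ n, IsSyzygy S (K n) (K (n - 1)) := fun n => by simpa using H (n - 1)
  refine ⟨K (0 - 1), hK 0, (gProjective_iff hS hE).2 ⟨fun n => K (n - 1), rfl, fun n => ?_⟩⟩
  simpa using hK n

/-- A class of objects in which every object has a syzygy and a cosyzygy consists of
`ξ`-Gorenstein projective objects. -/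
lemma gProjective_of_forall_exists (hS : IsProperClass S) (hE : HasEnoughXiProjectives S)
    (E : C → Prop) (hdown : ∀ A, E A → ∃ A', IsSyzygy S A' A ∧ E A')
    (hup : ∀ A, E A → ∃ A', IsSyzygy S A A' ∧ E A') {A : C} (hA : E A) : GProjective S A := by
  choose d hd hdE using hdown
  choose u hu huE using hup
  let D : Subtype E → Subtype E := fun A => ⟨d A.1 A.2, hdE A.1 A.2⟩
  let U : Subtype E → Subtype E := fun A => ⟨u A.1 A.2, huE A.1 A.2⟩
  let K : ℤ → C := fun n => match n with
    | Int.ofNat n => (D^[n] ⟨A, hA⟩).1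
    | Int.negSucc n => (U^[n + 1] ⟨A, hA⟩).1
  refine (gProjective_iff hS hE).2 ⟨K, rfl, fun n => ?_⟩
  match n with
  | Int.ofNat n =>
    change IsSyzygy S (D^[n + 1] ⟨A, hA⟩).1 (D^[n] ⟨A, hA⟩).1
    rw [Function.iterate_succ_apply']
    exact hd _ _
  | Int.negSucc 0 => exact hu A hA
  | Int.negSucc (n + 1) =>
    change IsSyzygy S (U^[n + 1] ⟨A, hA⟩).1 (U^[n + 1 + 1] ⟨A, hA⟩).1
    rw [Function.iterate_succ_apply' U (n + 1)]
    exact hu _ _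

/-- `Y` is an extension of `Z` by `X` along a triangle with biphantom connecting morphism. -/
def IsBiphantomExtension (S : Set (Triangle C)) (X Y Z : C) : Prop :=
  ∃ (f : X ⟶ Y) (g : Y ⟶ Z) (h : Z ⟶ X⟦(1 : ℤ)⟧),
    Triangle.mk f g h ∈ distTriang C ∧ IsBiphantom S h

/-- The horseshoe lemma for syzygies. -/
lemma IsBiphantomExtension.exists_syzygy (hS : IsProperClass S) {X Y Z X' Z' : C}
    (hY : IsBiphantomExtension S X Y Z) (hX : IsSyzygy S X' X) (hZ : IsSyzygy S Z' Z) :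
    ∃ Y', IsSyzygy S Y' Y ∧ IsBiphantomExtension S X' Y' Z' := by
  obtain ⟨i, j, w, hT, hw⟩ := hY
  obtain ⟨P, fX, gX, hX, hP, hTX, hhX⟩ := hX
  obtain ⟨Q, fZ, gZ, hZ, hQ, hTZ, hhZ⟩ := hZ
  obtain ⟨V, α, β, f', g', hV, hf', -⟩ := exists_base_change hT hTZ
  rw [hw.1 Q hQ gZ] at hf'
  obtain ⟨s, r, -, -, hr⟩ := exists_reversed_of_mor₃_eq_zero hf'
  obtain ⟨W, α', β', f'', g'', hW, hf'', -⟩ := exists_base_change hr hTX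
  rw [comp_zero] at hf''
  obtain ⟨Y', a, h, m, n, h₁, h₂, h₃, h₄⟩ := exists_fiber_comp hW hV S
  have hr' := hhX.precomp r
  have hj := hhZ.precomp j
  exact ⟨Y', ⟨W, a, _, h, .of_extension hS hf'' hQ hP, h₁, h₃ hr'.1 hj.1, h₄ hr'.2 hj.2⟩,
    m, n, _, h₂, hr'.precomp α⟩

/-- The horseshoe lemma for cosyzygies. -/
lemma IsBiphantomExtension.exists_cosyzygy (hS : IsProperClass S) {X Y Z X' Z' : C}
    (hY : IsBiphantomExtension S X Y Z) (hX : IsSyzygy S X X') (hZ : IsSyzygy S Z Z') :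
    ∃ Y', IsSyzygy S Y Y' ∧ IsBiphantomExtension S X' Y' Z' := by
  obtain ⟨i, j, w, hT, hw⟩ := hY
  obtain ⟨P, fX, gX, hX, hP, hTX, hhX⟩ := hX
  obtain ⟨Q, fZ, gZ, hZ, hQ, hTZ, hhZ⟩ := hZ
  obtain ⟨V, a, b, c, d, hV, hc⟩ := exists_cobase_change hT hTX
  rw [hw.2 _ (hP.shift hS) _] at hc
  obtain ⟨s, r, -, -, hs⟩ := exists_reversed_of_mor₃_eq_zero hc
  obtain ⟨W, a', b', c', d', hW, hc'⟩ := exists_cobase_change hs hTZ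
  rw [zero_comp] at hc'
  obtain ⟨Y', v, h, m, n, h₁, h₂, h₃, h₄⟩ := exists_cofiber_comp hV hW S
  have hi := hhX.comp (i⟦(1 : ℤ)⟧')
  have hs' := hhZ.comp (s⟦(1 : ℤ)⟧')
  exact ⟨Y', ⟨W, _, v, h, .of_extension hS hc' hQ hP, h₁, h₃ hi.1 hs'.1, h₄ hi.2 hs'.2⟩,
    m, n, _, h₂, hs'.comp _⟩

lemma IsPhantom.isCophantom (hS : IsProperClass S) (hE : HasEnoughXiProjectives S) {U V : C}
    {h : U ⟶ V} (hh : IsPhantom S h) (hU : GProjective S U) : IsCophantom S h := by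
  obtain ⟨U', ⟨P, f, g, k, hP, hT, hk⟩, -⟩ := hU.exists_syzygy hS hE
  intro Q hQ ψ
  obtain ⟨t, ht⟩ := exists_desc_mor₃ hT (h ≫ ψ)
    (by rw [← Category.assoc, hh P hP, zero_comp])
  rw [ht, hk.2 Q hQ]

/-- `ξ`-Gorenstein projective objects are closed under extensions along triangles with
phantom connecting morphism. -/
lemma GProjective.of_extension (hS : IsProperClass S) (hE : HasEnoughXiProjectives S)
    {X Y Z : C} {f : X ⟶ Y} {g : Y ⟶ Z} {h : Z ⟶ X⟦(1 : ℤ)⟧}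
    (hT : Triangle.mk f g h ∈ distTriang C) (hh : IsPhantom S h)
    (hX : GProjective S X) (hZ : GProjective S Z) : GProjective S Y := by
  refine gProjective_of_forall_exists hS hE
    (fun Y => ∃ X Z, GProjective S X ∧ GProjective S Z ∧ IsBiphantomExtension S X Y Z) ?_ ?_
    ⟨X, Z, hX, hZ, f, g, h, hT, hh, hh.isCophantom hS hE hZ⟩
  · rintro Y ⟨X, Z, hX, hZ, hY⟩
    obtain ⟨X', hXX', hX'⟩ := hX.exists_syzygy hS hE
    obtain ⟨Z', hZZ', hZ'⟩ := hZ.exists_syzygy hS hE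
    obtain ⟨Y', hYY', hY'⟩ := hY.exists_syzygy hS hXX' hZZ'
    exact ⟨Y', hYY', X', Z', hX', hZ', hY'⟩
  · rintro Y ⟨X, Z, hX, hZ, hY⟩
    obtain ⟨X', hXX', hX'⟩ := hX.exists_cosyzygy hS hE
    obtain ⟨Z', hZZ', hZ'⟩ := hZ.exists_cosyzygy hS hE
    obtain ⟨Y', hYY', hY'⟩ := hY.exists_cosyzygy hS hXX' hZZ'
    exact ⟨Y', hYY', X', Z', hX', hZ', hY'⟩

end EnoughProjectives

theorem xi_exact_seq_proj_right (S : Set (Triangle C))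
    (hS : IsProperClass S) (hE : HasEnoughXiProjectives S)
    (B G₁ G₀ A K : C) (f₁ : B ⟶ G₁) (g₁ : G₁ ⟶ K) (h₁ : K ⟶ B⟦(1 : ℤ)⟧)
    (f₂ : K ⟶ G₀) (g₂ : G₀ ⟶ A) (h₂ : A ⟶ K⟦(1 : ℤ)⟧)
    (hT₁ : Triangle.mk f₁ g₁ h₁ ∈ S) (hT₂ : Triangle.mk f₂ g₂ h₂ ∈ S)
    (hG₁ : GProjective S G₁) (hG₀ : GProjective S G₀) :
    ∃ (G₁' Q K' : C) (f₁' : B ⟶ G₁') (g₁' : G₁' ⟶ K') (h₁' : K' ⟶ B⟦(1 : ℤ)⟧)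
      (f₂' : K' ⟶ Q) (g₂' : Q ⟶ A) (h₂' : A ⟶ K'⟦(1 : ℤ)⟧),
      Triangle.mk f₁' g₁' h₁' ∈ S ∧ Triangle.mk f₂' g₂' h₂' ∈ S ∧
      GProjective S G₁' ∧ XiProjective S Q := by
  have hd₁ := hS.subset_dist hT₁
  have hd₂ := hS.subset_dist hT₂
  have hh₁ : IsPhantom S h₁ := isPhantom_mor₃ hS hT₁
  have hh₂ : IsPhantom S h₂ := isPhantom_mor₃ hS hT₂
  obtain ⟨L, ⟨Q, f, g, h, hQ, hT, hh⟩, hL⟩ := hG₀.exists_syzygy hS hE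
  obtain ⟨K', f₂', h₂', m, n, hK', hmn, hph, -⟩ := exists_fiber_comp hT hd₂ S
  obtain ⟨G₁', α, β, f₁', g₁', hG, hB, -⟩ := exists_base_change hd₁ hmn
  exact ⟨G₁', Q, K', f₁', g₁', n ≫ h₁, f₂', g ≫ g₂, h₂',
    mem_of_isPhantom hS hE hB (hh₁.precomp n), mem_of_isPhantom hS hE hK' (hph hh.1 hh₂),
    .of_extension hS hE hG ((hh.1.precomp f₂).precomp g₁) hL hG₁, hQ⟩

end GorensteinTriangulated
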